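/- There do not exist two subsets V and V' of the square I² = [0,1]×[0,1], each open in the subspace topology, with V ∪ V' = I², such that each of V and V' satisfies: (i) (t,t') belongs to the set iff (t',t) does; (ii) (t,0) belongs iff (t,1) does, and (0,t) belongs iff (1,t) does; and each carries a continuous function into ℤ (d on V, d' on V') satisfying d(t,1) − d(t,0) = −1 whenever (t,0),(t,1) are in the domain, d(1,t) − d(0,t) = 1 whenever (0,t),(1,t) are in the domain, and d(t',t) = −d(t,t') for all (t,t') in the domain (and the analogous three conditions for d'). -/

import Mathlib

/-- The unit square `I² = [0,1] × [0,1]` as a subset of `ℝ²`. -/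
def unitSquare : Set (ℝ × ℝ) := Set.Icc (0 : ℝ) 1 ×ˢ Set.Icc (0 : ℝ) 1

/-- Condition (i): `(t,t')` belongs to `V` iff `(t',t)` does; and (ii): `(t,0)` belongs
iff `(t,1)` does, and `(0,t)` belongs iff `(1,t)` does. -/
def EdgeSymmetric (V : Set (ℝ × ℝ)) : Prop :=
  (∀ t t' : ℝ, (t, t') ∈ V ↔ (t', t) ∈ V) ∧
  (∀ t : ℝ, (((t, (0 : ℝ)) ∈ V) ↔ ((t, (1 : ℝ)) ∈ V)) ∧
    ((((0 : ℝ), t) ∈ V) ↔ (((1 : ℝ), t) ∈ V)))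

/-- `d` is a continuous (hence locally constant) integer-valued function on `V`
satisfying `d(t,1) - d(t,0) = -1`, `d(1,t) - d(0,t) = 1`, and `d(t',t) = -d(t,t')`. -/
def IsDFunction (V : Set (ℝ × ℝ)) (d : V → ℤ) : Prop :=
  Continuous d ∧
  (∀ (t : ℝ) (h0 : (t, (0 : ℝ)) ∈ V) (h1 : (t, (1 : ℝ)) ∈ V),
    d ⟨(t, 1), h1⟩ - d ⟨(t, 0), h0⟩ = -1) ∧
  (∀ (t : ℝ) (h0 : ((0 : ℝ), t) ∈ V) (h1 : ((1 : ℝ), t) ∈ V),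
    d ⟨(1, t), h1⟩ - d ⟨(0, t), h0⟩ = 1) ∧
  (∀ (t t' : ℝ) (h : (t, t') ∈ V) (h' : (t', t) ∈ V),
    d ⟨(t', t), h'⟩ = - d ⟨(t, t'), h⟩)

open Complex in
/-- A continuous nowhere vanishing function on the plane has a continuous logarithm. -/
lemma exists_continuous_log {g : ℝ × ℝ → ℂ} (hg : Continuous g) (h0 : ∀ p, g p ≠ 0) :
    ∃ L : ℝ × ℝ → ℂ, Continuous L ∧ ∀ p, exp (L p) = g p := by
  obtain ⟨F, ⟨-, hF⟩, -⟩ := isCoveringMapOn_exp.existsUnique_continuousMap_lifts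
    ⟨g, hg⟩ (a₀ := (0, 0)) (e₀ := log (g (0, 0))) (exp_log (h0 _)) h0
  exact ⟨F, F.continuous, fun p ↦ congrFun hF p⟩

/-- Two continuous logarithms of the same function differ by a constant. -/
lemma sub_eq_sub_of_exp_eq {X : Type*} [TopologicalSpace X] [PreconnectedSpace X] {u v : X → ℂ}
    (hu : Continuous u) (hv : Continuous v) (h : ∀ x, Complex.exp (u x) = Complex.exp (v x))
    (x y : X) : u x - v x = u y - v y := by
  have key := Complex.isCoveringMap_exp.eq_of_comp_eq hu
    (g₂ := fun z ↦ v z + (u y - v y)) (by fun_prop)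
    (by
      funext z
      apply Subtype.ext
      simp [Complex.exp_add, Complex.exp_sub, h, Complex.exp_ne_zero]) y (by ring)
  rw [congrFun key x]
  ring

/-- Two symmetric real functions on the plane, the first nonnegative on the diagonal, changing sign
from the line `x = 0` to the line `x = 1`, have a common zero. -/
lemma exists_common_zero {f g : ℝ × ℝ → ℝ} (hf : Continuous f) (hg : Continuous g)
    (f_symm : ∀ x y, f (y, x) = f (x, y)) (g_symm : ∀ x y, g (y, x) = g (x, y))
    (f_diag : ∀ t, 0 ≤ f (t, t))
    (f_edge : ∀ t, f (0, t) * f (1, t) ≤ 0) (g_edge : ∀ t, g (0, t) * g (1, t) ≤ 0)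
    (f_edge_ne : ∀ t, f (0, t) ≠ 0 → f (1, t) ≠ 0)
    (g_edge_ne : ∀ t, g (0, t) ≠ 0 → g (1, t) ≠ 0) :
    ∃ p, f p = 0 ∧ g p = 0 := by
  by_contra! hne
  set G : ℝ × ℝ → ℂ := fun p ↦ ⟨f p, g p⟩ with hG
  have hGe : G = fun p ↦ (f p : ℂ) + g p * Complex.I := by
    funext p; apply Complex.ext <;> simp [hG]
  have hGc : Continuous G := by rw [hGe]; fun_prop
  have hG0 : ∀ p, G p ≠ 0 := fun p h ↦
    hne p (congrArg Complex.re h) (congrArg Complex.im h)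
  obtain ⟨L, hL, hLG⟩ := exists_continuous_log hGc hG0
  have hsymm : L (1, 0) = L (0, 1) := by
    have := sub_eq_sub_of_exp_eq (u := fun p : ℝ × ℝ ↦ L p) (v := fun p ↦ L p.swap) hL
      (by fun_prop) (fun p ↦ by simp [hLG, hG, Prod.swap, f_symm p.1, g_symm p.1]) (1, 0) (0, 0)
    simpa [sub_eq_zero] using this
  have hslit : ∀ t : ℝ, G (t, t) ∈ Complex.slitPlane := fun t ↦ by
    rw [Complex.mem_slitPlane_iff]
    rcases (f_diag t).lt_or_eq with h | h
    · exact .inl h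
    · exact .inr (hne _ h.symm)
  have hdiag := sub_eq_sub_of_exp_eq (u := fun t : ℝ ↦ L (t, t))
    (v := fun t ↦ Complex.log (G (t, t))) (by fun_prop)
    (Continuous.clog (by fun_prop) hslit)
    (fun t ↦ by rw [hLG, Complex.exp_log (hG0 _)]) 1 0
  set w : ℝ → ℂ := fun t ↦ -G (1, t) / G (0, t) with hw
  have hwre : ∀ t, 0 < (w t).re := fun t ↦ by
    have hpos : 0 < -(f (0, t) * f (1, t)) - g (0, t) * g (1, t) := by
      by_cases h : f (0, t) = 0
      · have h' := hne _ h
        have := (g_edge t).lt_of_ne (mul_ne_zero h' (g_edge_ne t h'))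
        linarith [f_edge t]
      · have := (f_edge t).lt_of_ne (mul_ne_zero h (f_edge_ne t h))
        linarith [g_edge t]
    have hn : 0 < Complex.normSq (G (0, t)) := Complex.normSq_pos.2 (hG0 _)
    have : (w t).re =
        (-(f (0, t) * f (1, t)) - g (0, t) * g (1, t)) / Complex.normSq (G (0, t)) := by
      simp only [hw, Complex.div_re, Complex.neg_re, Complex.neg_im, hG]
      ring
    rw [this]
    positivity
  have hw0 : ∀ t, w t ≠ 0 := fun t h ↦ by simpa [h] using hwre t
  have hwexp : ∀ t, Complex.exp (L (1, t) - L (0, t) - Real.pi * Complex.I) = w t := fun t ↦ by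
    rw [Complex.exp_sub, Complex.exp_sub, hLG, hLG, Complex.exp_pi_mul_I, hw]
    ring
  have hedge := sub_eq_sub_of_exp_eq
    (u := fun t : ℝ ↦ L (1, t) - L (0, t) - Real.pi * Complex.I)
    (v := fun t ↦ Complex.log (w t)) (by fun_prop)
    (Continuous.clog (Continuous.div₀ (by fun_prop) (by fun_prop) fun t ↦ hG0 _)
      fun t ↦ .inl (hwre t))
    (fun t ↦ by rw [hwexp, Complex.exp_log (hw0 t)]) 1 0
  obtain ⟨n, hn⟩ := Complex.exp_eq_exp_iff_exists_int.1
    ((hwexp 0).trans (Complex.exp_log (hw0 0)).symm)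
  have d1 := congrArg Complex.im hdiag
  have e1 := congrArg Complex.im hedge
  have n1 := congrArg Complex.im hn
  simp [hsymm, Complex.log_im] at d1 e1 n1
  have a0 := abs_le.1 (Complex.abs_arg_le_pi_div_two_iff (z := G (0, 0)) |>.2 (f_diag 0))
  have a1 := abs_le.1 (Complex.abs_arg_le_pi_div_two_iff (z := G (1, 1)) |>.2 (f_diag 1))
  have b0 := abs_lt.1 (Complex.abs_arg_lt_pi_div_two_iff.2 (.inl (hwre 0)))
  have b1 := abs_lt.1 (Complex.abs_arg_lt_pi_div_two_iff.2 (.inl (hwre 1)))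
  have hpi := Real.pi_pos
  rcases le_or_gt 0 n with h | h
  · have : (0 : ℝ) ≤ n * Real.pi := mul_nonneg (by exact_mod_cast h) hpi.le
    linarith
  · have h' : (n : ℝ) ≤ -1 := by exact_mod_cast Int.le_sub_one_of_lt h
    have : (n : ℝ) * Real.pi ≤ -1 * Real.pi := mul_le_mul_of_nonneg_right h' hpi.le
    linarith

/-- The parity of a `d`-function on a relatively open set `V` is the sign of a continuous function
on the square whose nonvanishing locus is `V`. -/
lemma IsDFunction.exists_continuousOn_sign {V : Set (ℝ × ℝ)} {d : V → ℤ}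
    (hV : ∃ O : Set (ℝ × ℝ), IsOpen O ∧ V = O ∩ unitSquare) (hs : EdgeSymmetric V)
    (hd : IsDFunction V d) :
    ∃ f : ℝ × ℝ → ℝ, ContinuousOn f unitSquare ∧ (∀ p, f p ≠ 0 ↔ p ∈ V) ∧
      (∀ x y, f (y, x) = f (x, y)) ∧ (∀ t, 0 ≤ f (t, t)) ∧
      ∀ t, f (0, t) * f (1, t) ≤ 0 := by
  classical
  obtain ⟨O, hO, hVO⟩ := hV
  obtain ⟨hdc, -, hd1, hd2⟩ := hd
  set C : Set (ℝ × ℝ) := insert (2, 2) Oᶜ with hC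
  have hCc : IsClosed C := by
    rw [hC, Set.insert_eq]
    exact isClosed_singleton.union hO.isClosed_compl
  have hCn : C.Nonempty := Set.insert_nonempty _ _
  set φ : ℝ × ℝ → ℝ := fun p ↦ Metric.infDist p C + Metric.infDist p.swap C with hφ
  have hφc : Continuous φ :=
    (Metric.continuous_infDist_pt C).add ((Metric.continuous_infDist_pt C).comp continuous_swap)
  have hφ0 : ∀ p, 0 ≤ φ p := fun p ↦ add_nonneg Metric.infDist_nonneg Metric.infDist_nonneg
  have hVC : ∀ p ∈ V, p ∉ C := by
    intro p hp hpC
    rw [hVO] at hp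
    rcases hpC with rfl | hpC
    · have := hp.2.1.2
      norm_num at this
    · exact hpC hp.1
  have hφV : ∀ p ∈ V, 0 < φ p := fun p hp ↦
    add_pos_of_pos_of_nonneg ((hCc.notMem_iff_infDist_pos hCn).1 (hVC p hp)) Metric.infDist_nonneg
  have hC_of : ∀ p ∈ unitSquare, p ∉ V → p ∈ C := fun p hp hpV ↦
    .inr fun h ↦ hpV (hVO ▸ ⟨h, hp⟩)
  have hφn : ∀ p ∈ unitSquare, p ∉ V → φ p = 0 := fun p hp hpV ↦ by
    have h1 := hC_of p hp hpV
    have h2 := hC_of p.swap ⟨hp.2, hp.1⟩ fun h ↦ hpV ((hs.1 _ _).2 h)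
    simp [hφ, Metric.infDist_zero_of_mem, h1, h2]
  set f : ℝ × ℝ → ℝ := fun p ↦ if h : p ∈ V then φ p * (-1) ^ d ⟨p, h⟩ else 0 with hf
  have hfV : ∀ p (h : p ∈ V), f p = φ p * (-1) ^ d ⟨p, h⟩ := fun p h ↦ dif_pos h
  have hfn : ∀ p, p ∉ V → f p = 0 := fun p h ↦ dif_neg h
  refine ⟨f, fun p hp ↦ ?_, fun p ↦ ⟨fun h ↦ ?_, fun h ↦ ?_⟩, fun x y ↦ ?_, fun t ↦ ?_, fun t ↦ ?_⟩
  · by_cases h : p ∈ V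
    · obtain ⟨U, hU, hUd⟩ := isOpen_induced_iff.1 ((isOpen_discrete {d ⟨p, h⟩}).preimage hdc)
      have hUd' : ∀ q : V, (q : ℝ × ℝ) ∈ U ↔ d q = d ⟨p, h⟩ := fun q ↦ by
        simpa using Set.ext_iff.1 hUd q
      have hnhds : U ∩ O ∈ nhds p :=
        (hU.inter hO).mem_nhds ⟨(hUd' ⟨p, h⟩).2 rfl, (hVO ▸ h : p ∈ O ∩ unitSquare).1⟩
      refine ContinuousWithinAt.congr_of_eventuallyEq
        (f := fun q ↦ φ q * (-1) ^ d ⟨p, h⟩) (by fun_prop) ?_ (hfV p h)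
      filter_upwards [mem_nhdsWithin_of_mem_nhds hnhds, self_mem_nhdsWithin] with q hq hqS
      have hqV : q ∈ V := hVO ▸ ⟨hq.2, hqS⟩
      rw [hfV q hqV, (hUd' ⟨q, hqV⟩).1 hq.1]
    · have hlim := hφc.continuousWithinAt (s := unitSquare) (x := p)
      rw [ContinuousWithinAt, hφn p hp h] at hlim
      rw [ContinuousWithinAt, hfn p h]
      refine squeeze_zero_norm (fun q ↦ ?_) hlim
      by_cases hq : q ∈ V
      · simp [hfV q hq, abs_of_nonneg (hφ0 q)]
      · simpa [hfn q hq] using hφ0 q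
  · by_contra hp
    exact h (hfn p hp)
  · rw [hfV p h]
    exact mul_ne_zero (hφV p h).ne' (zpow_ne_zero _ (by norm_num))
  · by_cases h : (x, y) ∈ V
    · have h' := (hs.1 x y).1 h
      rw [hfV _ h, hfV _ h', hd2 x y h h', zpow_neg, ← inv_zpow]
      simp [hφ, add_comm, inv_neg]
    · rw [hfn _ h, hfn _ fun h' ↦ h ((hs.1 x y).2 h')]
  · by_cases h : (t, t) ∈ V
    · have h0 : d ⟨(t, t), h⟩ = 0 := by
        have := hd2 t t h h
        omega
      rw [hfV _ h, h0]
      simpa using hφ0 (t, t)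
    · rw [hfn _ h]
  · by_cases h : ((0 : ℝ), t) ∈ V
    · have h' := (hs.2 t).2.1 h
      have h1 : d ⟨(1, t), h'⟩ = d ⟨(0, t), h⟩ + 1 := by
        have := hd1 t h h'
        omega
      rw [hfV _ h, hfV _ h', h1, zpow_add_one₀ (by norm_num)]
      have := mul_nonneg (mul_nonneg (hφ0 (0, t)) (hφ0 (1, t)))
        (mul_self_nonneg ((-1 : ℝ) ^ d ⟨(0, t), h⟩))
      linarith
    · simp [hfn _ h]

/-- The unit square cannot be covered by two relatively open subsets, each symmetric
with matching behavior on opposite edges, carrying continuous integer-valued functions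
`d`, `d'` satisfying the three defining conditions. -/
theorem no_two_d_functions_cover :
    ¬ ∃ (V V' : Set (ℝ × ℝ)) (d : V → ℤ) (d' : V' → ℤ),
      (∃ O : Set (ℝ × ℝ), IsOpen O ∧ V = O ∩ unitSquare) ∧
      (∃ O : Set (ℝ × ℝ), IsOpen O ∧ V' = O ∩ unitSquare) ∧
      V ∪ V' = unitSquare ∧
      EdgeSymmetric V ∧ EdgeSymmetric V' ∧
      IsDFunction V d ∧ IsDFunction V' d' := by
  rintro ⟨V, V', d, d', hV, hV', hcov, hs, hs', hd, hd'⟩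
  obtain ⟨f, hf, f_ne, f_symm, f_diag, f_edge⟩ := hd.exists_continuousOn_sign hV hs
  obtain ⟨g, hg, g_ne, g_symm, -, g_edge⟩ := hd'.exists_continuousOn_sign hV' hs'
  set κ : ℝ → ℝ := fun t ↦ max 0 (min t 1) with hκ
  have κ0 : κ 0 = 0 := by simp [hκ]
  have κ1 : κ 1 = 1 := by simp [hκ]
  have hκI : ∀ t, κ t ∈ Set.Icc (0 : ℝ) 1 := fun t ↦ by simp [hκ]
  have hκc : Continuous fun p : ℝ × ℝ ↦ (κ p.1, κ p.2) := by fun_prop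
  have hκS : ∀ p : ℝ × ℝ, (κ p.1, κ p.2) ∈ unitSquare := fun p ↦ ⟨hκI _, hκI _⟩
  obtain ⟨p, hfp, hgp⟩ := exists_common_zero (hf.comp_continuous hκc hκS)
    (hg.comp_continuous hκc hκS) (fun _ _ ↦ f_symm _ _) (fun _ _ ↦ g_symm _ _)
    (fun _ ↦ f_diag _)
    (fun t ↦ by simpa only [Function.comp_apply, κ0, κ1] using f_edge (κ t))
    (fun t ↦ by simpa only [Function.comp_apply, κ0, κ1] using g_edge (κ t))
    (fun t ↦ by simpa only [Function.comp_apply, κ0, κ1, f_ne] using (hs.2 (κ t)).2.1)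
    (fun t ↦ by simpa only [Function.comp_apply, κ0, κ1, g_ne] using (hs'.2 (κ t)).2.1)
  rcases (hcov.symm ▸ hκS p : _ ∈ V ∪ V') with h | h
  · exact (f_ne _).2 h hfp
  · exact (g_ne _).2 h hgp
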